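/- Let A be an affine subspace of ℝ^n with ∅ ≠ A ∩ B₁ and A ∩ B₁ ≠ aff(A ∩ B₁). Let G be a face of A ∩ B₁ that is exposed relative to aff(A ∩ B₁), i.e. G = (A ∩ B₁) ∩ {x : ⟨α, x⟩ = β} for some α, β with ⟨α, x⟩ ≤ β for all x ∈ A ∩ B₁ and ⟨α, ·⟩ nonconstant on aff(A ∩ B₁). Let x̄ ∈ ri(G), s̄ = sign(D*x̄), and F̄ = B₁ ∩ {x ∈ ℝ^n : ⟨Ds̄, x⟩ = 1}. Then G = A ∩ F̄. -/

import Mathlib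

open Matrix Set

noncomputable section

/-- `Vec n` is `ℝ^n`. -/
abbrev Vec (n : ℕ) := Fin n → ℝ

/-- The ℓ¹-norm on `ℝ^p`. -/
def l1 {p : ℕ} (θ : Vec p) : ℝ := ∑ i, |θ i|

/-- The componentwise sign vector. -/
def sgn {p : ℕ} (θ : Vec p) : Vec p := fun i => Real.sign (θ i)

/-- `s` is a sign vector, i.e. `s ∈ {-1,0,1}^p`. -/
def IsSignVec {p : ℕ} (s : Vec p) : Prop := ∀ i, s i = -1 ∨ s i = 0 ∨ s i = 1

/-- The order `s ≼ s'` on sign vectors: `sᵢ ≠ 0 → s'ᵢ = sᵢ`. -/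
def sleq {p : ℕ} (s s' : Vec p) : Prop := ∀ i, s i ≠ 0 → s' i = s i

/-- The cosupport `{i : uᵢ = 0}`. -/
def cosupp {p : ℕ} (u : Vec p) : Set (Fin p) := {i | u i = 0}

/-- The analysis operator `D* x = Dᵀ x`. -/
def Dstar {n p : ℕ} (D : Matrix (Fin n) (Fin p) ℝ) (x : Vec n) : Vec p := Dᵀ *ᵥ x

/-- The ball `B_r = {x : ‖D*x‖₁ ≤ r}`. -/
def Ball {n p : ℕ} (D : Matrix (Fin n) (Fin p) ℝ) (r : ℝ) : Set (Vec n) :=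
  {x | l1 (Dstar D x) ≤ r}

/-- The sphere `∂B_r = {x : ‖D*x‖₁ = r}`. -/
def Sph {n p : ℕ} (D : Matrix (Fin n) (Fin p) ℝ) (r : ℝ) : Set (Vec n) :=
  {x | l1 (Dstar D x) = r}

/-- `Ker D*_J = {x : (D*x)ᵢ = 0 for all i ∈ J}`. -/
def kerDJ {n p : ℕ} (D : Matrix (Fin n) (Fin p) ℝ) (J : Set (Fin p)) : Set (Vec n) :=
  {x | ∀ i ∈ J, Dstar D x i = 0}

/-- The relative interior of a set. -/
def ri {n : ℕ} (C : Set (Vec n)) : Set (Vec n) := intrinsicInterior ℝ C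

/-- The direction of (the affine hull of) a set, as a set of vectors. -/
def dir {n : ℕ} (C : Set (Vec n)) : Set (Vec n) := ((affineSpan ℝ C).direction : Set (Vec n))

/-- `F` is an exposed face of `X`: the intersection of `X` with a supporting hyperplane. -/
def IsExposedFace {n : ℕ} (X F : Set (Vec n)) : Prop :=
  ∃ (α : Vec n) (β : ℝ), α ≠ 0 ∧ (∀ x ∈ X, α ⬝ᵥ x ≤ β) ∧ F = X ∩ {x | α ⬝ᵥ x = β}

/-- `G` is a face of `X`: a convex extreme subset of `X`. -/
def IsFace {n : ℕ} (X G : Set (Vec n)) : Prop := Convex ℝ G ∧ IsExtreme ℝ X G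

/-- `x` is an extreme point of `C`: it is not the midpoint of two distinct points of `C`. -/
def IsExtremePt {n : ℕ} (C : Set (Vec n)) (x : Vec n) : Prop :=
  x ∈ C ∧ ∀ x₁ ∈ C, ∀ x₂ ∈ C, x = midpoint ℝ x₁ x₂ → x₁ = x₂

/-- The objective `L(x) = (1/2)‖y − Φx‖₂² + λ‖D*x‖₁`. -/
def Lfun {n p q : ℕ} (D : Matrix (Fin n) (Fin p) ℝ) (Phi : Matrix (Fin q) (Fin n) ℝ)
    (y : Vec q) (lam : ℝ) (x : Vec n) : ℝ :=
  (1/2 : ℝ) * ((y - Phi *ᵥ x) ⬝ᵥ (y - Phi *ᵥ x)) + lam * l1 (Dstar D x)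

lemma aux_sign_mul (a : ℝ) : Real.sign a * a = |a| := by
  rcases lt_trichotomy a 0 with h | h | h
  · rw [Real.sign_of_neg h, abs_of_neg h]; ring
  · simp [h]
  · rw [Real.sign_of_pos h, abs_of_pos h]; ring

lemma aux_sign_mul_le (a b : ℝ) : Real.sign a * b ≤ |b| := by
  rcases Real.sign_apply_eq a with h | h | h <;> rw [h]
  · have := neg_le_abs b; linarith
  · have := abs_nonneg b; linarith
  · have := le_abs_self b; linarith

lemma aux_dual {n p : ℕ} (D : Matrix (Fin n) (Fin p) ℝ) (s : Vec p) (x : Vec n) :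
    (D *ᵥ s) ⬝ᵥ x = ∑ i, s i * Dstar D x i := by
  unfold Dstar
  rw [dotProduct_comm, dotProduct_mulVec, ← mulVec_transpose, dotProduct_comm]
  rfl

lemma aux_line {n p : ℕ} (D : Matrix (Fin n) (Fin p) ℝ) (x y : Vec n) (t : ℝ) (i : Fin p) :
    Dstar D (x + t • (y - x)) i = Dstar D x i + t * (Dstar D y i - Dstar D x i) := by
  unfold Dstar
  simp [mulVec_add, mulVec_smul, mulVec_sub]

lemma aux_neg {P : ℝ → Prop} (h : ∀ᶠ t in nhds (0 : ℝ), P t) : ∃ t < 0, P t := by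
  obtain ⟨e, he, h⟩ := Metric.eventually_nhds_iff.1 h
  refine ⟨-(e/2), by linarith, h ?_⟩
  rw [Real.dist_eq, sub_zero, abs_neg, abs_of_pos (by linarith)]
  linarith

lemma aux_ri {n : ℕ} (G : Set (Vec n)) (x y : Vec n) (hx : x ∈ ri G) (hy : y ∈ G) :
    ∃ t < (0:ℝ), x + t • (y - x) ∈ G := by
  apply aux_neg
  obtain ⟨⟨x', hx'⟩, hint, rfl⟩ := mem_intrinsicInterior.1 hx
  have hm : ∀ t : ℝ, x' + t • (y - x') ∈ affineSpan ℝ G := by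
    intro t
    have := AffineMap.lineMap_mem t hx' (subset_affineSpan ℝ G hy)
    rw [AffineMap.lineMap_apply, vsub_eq_sub, vadd_eq_add, add_comm] at this
    exact this
  have hc : Continuous (fun t : ℝ => (⟨x' + t • (y - x'), hm t⟩ : affineSpan ℝ G)) := by
    apply Continuous.subtype_mk
    fun_prop
  have h0 : (⟨x' + (0:ℝ) • (y - x'), hm 0⟩ : affineSpan ℝ G) = ⟨x', hx'⟩ := by
    simp
  have hn := mem_interior_iff_mem_nhds.1 hint
  rw [← h0] at hn
  exact hc.continuousAt.preimage_mem_nhds hn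

/-- let `∅ ≠ A ∩ B₁ ≠ aff(A ∩ B₁)` and let `G` be a face of `A ∩ B₁` exposed
relative to `aff(A ∩ B₁)`, i.e. cut out by a supporting functional `⟨α, ·⟩ ≤ β` which is
nonconstant on `aff(A ∩ B₁)`. If `x̄ ∈ ri(G)`, `s̄ = sign(D*x̄)`, and
`F̄ = B₁ ∩ {x : ⟨Ds̄, x⟩ = 1}`, then `G = A ∩ F̄`. -/
theorem stmt_10 {n p : ℕ} (hn : 0 < n) (hp : 0 < p) (D : Matrix (Fin n) (Fin p) ℝ)
    (A : AffineSubspace ℝ (Vec n))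
    (hne : ((A : Set (Vec n)) ∩ Ball D 1).Nonempty)
    (hnaff : (A : Set (Vec n)) ∩ Ball D 1 ≠
      (affineSpan ℝ ((A : Set (Vec n)) ∩ Ball D 1) : Set (Vec n)))
    (G : Set (Vec n)) (α : Vec n) (β : ℝ)
    (hsupp : ∀ x ∈ (A : Set (Vec n)) ∩ Ball D 1, α ⬝ᵥ x ≤ β)
    (hG : G = ((A : Set (Vec n)) ∩ Ball D 1) ∩ {x | α ⬝ᵥ x = β})
    (hnc : ∃ u ∈ (affineSpan ℝ ((A : Set (Vec n)) ∩ Ball D 1) : Set (Vec n)),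
      ∃ v ∈ (affineSpan ℝ ((A : Set (Vec n)) ∩ Ball D 1) : Set (Vec n)), α ⬝ᵥ u ≠ α ⬝ᵥ v)
    (xb : Vec n) (hxb : xb ∈ ri G)
    (sb : Vec p) (hsb : sb = sgn (Dstar D xb))
    (Fb : Set (Vec n)) (hFb : Fb = Ball D 1 ∩ {x | (D *ᵥ sb) ⬝ᵥ x = 1}) :
    G = (A : Set (Vec n)) ∩ Fb := by
  have hxG : xb ∈ G := intrinsicInterior_subset hxb
  have hxG' := hxG
  rw [hG] at hxG'
  obtain ⟨⟨hxA, hxB⟩, hxα⟩ := hxG'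
  have hxα : α ⬝ᵥ xb = β := hxα
  have hxB : l1 (Dstar D xb) ≤ 1 := hxB
  have hA : ∀ y ∈ A, ∀ t : ℝ, xb + t • (y - xb) ∈ A := by
    intro y hy t
    have := AffineMap.lineMap_mem t hxA hy
    rw [AffineMap.lineMap_apply, vsub_eq_sub, vadd_eq_add, add_comm] at this
    exact this
  have hkey : ∀ y ∈ A, ∀ t < (0:ℝ), l1 (Dstar D (xb + t • (y - xb))) ≤ 1 → β ≤ α ⬝ᵥ y := by
    intro y hy t ht hl
    have h := hsupp _ ⟨hA y hy t, hl⟩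
    rw [dotProduct_add, dotProduct_smul, dotProduct_sub, hxα, smul_eq_mul] at h
    nlinarith
  have hcont : ∀ y i, Continuous fun t : ℝ => Dstar D (xb + t • (y - xb)) i := by
    intro y i
    simp only [aux_line]
    fun_prop
  have hs : ∀ i, sb i = Real.sign (Dstar D xb i) := by
    intro i; rw [hsb]; rfl
  have hle : ∀ y, (D *ᵥ sb) ⬝ᵥ y ≤ l1 (Dstar D y) := by
    intro y
    rw [aux_dual]
    exact Finset.sum_le_sum fun i _ => by rw [hs]; exact aux_sign_mul_le _ _
  have heq : (D *ᵥ sb) ⬝ᵥ xb = l1 (Dstar D xb) := by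
    rw [aux_dual]
    exact Finset.sum_congr rfl fun i _ => by rw [hs]; exact aux_sign_mul _
  have hone : l1 (Dstar D xb) = 1 := by
    by_contra hne1
    have hlt : l1 (Dstar D xb) < 1 := lt_of_le_of_ne hxB hne1
    have hall : ∀ y ∈ (A : Set (Vec n)) ∩ Ball D 1, α ⬝ᵥ y = β := by
      intro y hy
      have hc : Continuous fun t : ℝ => l1 (Dstar D (xb + t • (y - xb))) := by
        unfold l1
        exact continuous_finsetSum _ fun i _ => (hcont y i).abs
      have hev := hc.continuousAt.eventually_lt (continuousAt_const (y := (1:ℝ)))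
        (x₀ := (0:ℝ)) (by simpa using hlt)
      obtain ⟨t, ht, h⟩ := aux_neg hev
      exact le_antisymm (hsupp y hy) (hkey y hy.1 t ht h.le)
    have hspan : ∀ u ∈ affineSpan ℝ ((A : Set (Vec n)) ∩ Ball D 1), α ⬝ᵥ u = β := by
      intro u hu
      refine affineSpan_induction (p := fun u => α ⬝ᵥ u = β) hu hall ?_
      intro c u v w hu hv hw
      rw [vsub_eq_sub, vadd_eq_add, dotProduct_add, dotProduct_smul, dotProduct_sub, hu, hv, hw]
      simp
    obtain ⟨u, hu, v, hv, huv⟩ := hnc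
    exact huv ((hspan u hu).trans (hspan v hv).symm)
  ext y
  constructor
  · intro hy
    have hy' := hy
    rw [hG] at hy'
    rw [hFb]
    refine ⟨hy'.1.1, hy'.1.2, ?_⟩
    obtain ⟨t, ht, hz⟩ := aux_ri G xb y hxb hy
    rw [hG] at hz
    have hzB : l1 (Dstar D (xb + t • (y - xb))) ≤ 1 := hz.1.2
    have hyB : l1 (Dstar D y) ≤ 1 := hy'.1.2
    have h1 := (hle _).trans hzB
    have h2 := (hle _).trans hyB
    rw [dotProduct_add, dotProduct_smul, dotProduct_sub, heq, hone, smul_eq_mul] at h1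
    show (D *ᵥ sb) ⬝ᵥ y = 1
    apply le_antisymm h2
    nlinarith
  · intro hy
    rw [hFb] at hy
    obtain ⟨hyA, hyB, hy1⟩ := hy
    have hyB' : l1 (Dstar D y) ≤ 1 := hyB
    have hy1 : (D *ᵥ sb) ⬝ᵥ y = 1 := hy1
    have hterm : ∀ i, sb i * Dstar D y i = |Dstar D y i| := by
      have hsum : ∑ i, sb i * Dstar D y i = ∑ i, |Dstar D y i| := by
        rw [← aux_dual]
        exact le_antisymm (hle y) (by rw [hy1]; exact hyB')
      have := (Finset.sum_eq_sum_iff_of_le (s := Finset.univ) (fun i _ => by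
        rw [hs]; exact aux_sign_mul_le _ _)).1 hsum
      exact fun i => this i (Finset.mem_univ i)
    have hev : ∀ᶠ t in nhds (0:ℝ), ∀ i, |Dstar D (xb + t • (y - xb)) i| =
        sb i * Dstar D (xb + t • (y - xb)) i := by
      rw [Filter.eventually_all]
      intro i
      rcases lt_trichotomy (Dstar D xb i) 0 with h | h | h
      · filter_upwards [(hcont y i).continuousAt.eventually_lt (continuousAt_const (y := (0:ℝ)))
          (x₀ := (0:ℝ)) (by simpa using h)] with t ht
        rw [hs, Real.sign_of_neg h, abs_of_neg ht]; ring
      · have hs0 : sb i = 0 := by rw [hs, h, Real.sign_zero]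
        have h0 : Dstar D y i = 0 := by
          have := hterm i
          rw [hs0, zero_mul] at this
          exact abs_eq_zero.1 this.symm
        refine Filter.Eventually.of_forall fun t => ?_
        rw [aux_line, h, h0]; simp
      · filter_upwards [(continuousAt_const (y := (0:ℝ))).eventually_lt (hcont y i).continuousAt
          (x₀ := (0:ℝ)) (by simpa using h)] with t ht
        rw [hs, Real.sign_of_pos h, abs_of_pos ht]; ring
    obtain ⟨t, ht, h⟩ := aux_neg hev
    rw [hG]
    refine ⟨⟨hyA, hyB⟩, le_antisymm (hsupp y ⟨hyA, hyB⟩) (hkey y hyA t ht ?_)⟩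
    have : l1 (Dstar D (xb + t • (y - xb))) = (D *ᵥ sb) ⬝ᵥ (xb + t • (y - xb)) := by
      rw [aux_dual]
      exact Finset.sum_congr rfl fun i _ => h i
    rw [this, dotProduct_add, dotProduct_smul, dotProduct_sub, heq, hone, hy1]
    simp
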